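/- Let A be a unital associative algebra over a commutative unital ring R that is 2-torsion free and (n−1)-torsion free, let e be a nontrivial idempotent in A and f = 1 − e, suppose A satisfies property (Q), let n ≥ 2, and let φ be a Lie n-derivation on A. Suppose (i) fφ(a)f ∈ fZ(A)f for every a ∈ eAe and eφ(b)e ∈ eZ(A)e for every b ∈ fAf, and suppose at least one of the following holds: (ii-1) there exists m₀ ∈ eAf such that Z(A) = {a + b : a ∈ eZ(A)e, b ∈ fZ(A)f, am₀ = m₀b}; (ii-2) there exists t₀ ∈ fAe such that Z(A) = {a + b : a ∈ eZ(A)e, b ∈ fZ(A)f, t₀a = bt₀}. Then eφ(tm)e + fφ(mt)f ∈ Z(A) for every m ∈ eAf and t ∈ fAe. -/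

import Mathlib

open Finset

/-- Iterated commutator: `pCom x k = p_{k+1}(x 0, ..., x k)`, i.e.
`pCom x 0 = x 0` and `pCom x (k+1) = [pCom x k, x (k+1)]`. -/
def pCom {A : Type*} [Ring A] (x : ℕ → A) : ℕ → A
  | 0 => x 0
  | k + 1 => pCom x k * x (k + 1) - x (k + 1) * pCom x k

/-- `φ` is a Lie `n`-derivation. -/
def IsLieNDeriv {R : Type*} {A : Type*} [CommRing R] [Ring A] [Algebra R A]
    (n : ℕ) (φ : A →ₗ[R] A) : Prop :=
  ∀ x : ℕ → A,
    φ (pCom x (n - 1)) =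
      ∑ i ∈ Finset.range n, pCom (Function.update x i (φ (x i))) (n - 1)

/-- `d` is a derivation. -/
def IsDeriv {R : Type*} {A : Type*} [CommRing R] [Ring A] [Algebra R A]
    (d : A →ₗ[R] A) : Prop :=
  ∀ x y : A, d (x * y) = d x * y + x * d y

/-- `δ` is a Jordan derivation. -/
def IsJordanDeriv {R : Type*} {A : Type*} [CommRing R] [Ring A] [Algebra R A]
    (δ : A →ₗ[R] A) : Prop :=
  ∀ x y : A, δ (x * y + y * x) = δ x * y + y * δ x + x * δ y + δ y * x

/-- `δ` is an antiderivation. -/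
def IsAntiDeriv {R : Type*} {A : Type*} [CommRing R] [Ring A] [Algebra R A]
    (δ : A →ₗ[R] A) : Prop :=
  ∀ x y : A, δ (x * y) = δ y * x + y * δ x

/-- `δ` is a singular Jordan derivation relative to the idempotent `e`
(with `f = 1 - e`): it is a Jordan derivation killing `eAe` and `fAf`,
mapping `eAf` into `fAe` and `fAe` into `eAf`. -/
def IsSingularJordanDeriv {R : Type*} {A : Type*} [CommRing R] [Ring A] [Algebra R A]
    (e : A) (δ : A →ₗ[R] A) : Prop :=
  IsJordanDeriv δ ∧
  (∀ a : A, δ (e * a * e) = 0) ∧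
  (∀ b : A, δ ((1 - e) * b * (1 - e)) = 0) ∧
  (∀ m : A, δ (e * m * (1 - e)) = (1 - e) * δ (e * m * (1 - e)) * e) ∧
  (∀ t : A, δ ((1 - e) * t * e) = e * δ ((1 - e) * t * e) * (1 - e))

/-- `z` is a central element. -/
def IsCent {A : Type*} [Ring A] (z : A) : Prop := ∀ y : A, z * y = y * z

/-- The centre of `A` as a set. -/
def centerSet (A : Type*) [Ring A] : Set A := {z : A | ∀ y : A, z * y = y * z}

/-- `γ` vanishes on all `(n-1)`-th commutators. -/
def VanishesOnNCommutators {R : Type*} {A : Type*} [CommRing R] [Ring A] [Algebra R A]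
    (n : ℕ) (γ : A →ₗ[R] A) : Prop :=
  ∀ x : ℕ → A, γ (pCom x (n - 1)) = 0

/-- A Lie `n`-derivation is standard if it is the sum of a derivation and a
central-valued map vanishing on all `(n-1)`-th commutators. -/
def IsStandardLieNDeriv {R : Type*} {A : Type*} [CommRing R] [Ring A] [Algebra R A]
    (n : ℕ) (φ : A →ₗ[R] A) : Prop :=
  ∃ d γ : A →ₗ[R] A,
    IsDeriv d ∧ (∀ x : A, IsCent (γ x)) ∧ VanishesOnNCommutators n γ ∧ φ = d + γ

/-- Property (Q) for the idempotent `e` (with `f = 1 - e`):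
`exe·eAf = 0 = fAe·exe` implies `exe = 0`, and
`eAf·fxf = 0 = fxf·fAe` implies `fxf = 0`. -/
def PropQ {A : Type*} [Ring A] (e : A) : Prop :=
  (∀ x : A,
    ((∀ y : A, (e * x * e) * (e * y * (1 - e)) = 0) ∧
     (∀ y : A, ((1 - e) * y * e) * (e * x * e) = 0)) → e * x * e = 0) ∧
  (∀ x : A,
    ((∀ y : A, (e * y * (1 - e)) * ((1 - e) * x * (1 - e)) = 0) ∧
     (∀ y : A, ((1 - e) * x * (1 - e)) * ((1 - e) * y * e) = 0)) →
        (1 - e) * x * (1 - e) = 0)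

/-- `A` is `k`-torsion free. -/
def TorsionFreeAt (A : Type*) [Ring A] (k : ℕ) : Prop :=
  ∀ x : A, k • x = 0 → x = 0

/-- The centre of the corner algebra `gAg` (for an idempotent `g`). -/
def cornerCenter {A : Type*} [Ring A] (g : A) : Set A :=
  {z : A | z = g * z * g ∧ ∀ a : A, z * (g * a * g) = (g * a * g) * z}

/-- The corner algebra `gAg` has no nonzero central ideal: every
ideal of `gAg` consisting of elements central in `gAg` is zero. -/
def NoNonzeroCentralIdeal (R : Type*) [CommRing R] (A : Type*) [Ring A] [Algebra R A]
    (g : A) : Prop :=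
  ∀ I : Set A, (0 : A) ∈ I →
    (∀ x ∈ I, x = g * x * g) →
    (∀ x ∈ I, ∀ y ∈ I, x + y ∈ I) →
    (∀ r : R, ∀ x ∈ I, r • x ∈ I) →
    (∀ x ∈ I, ∀ a : A, (g * a * g) * x ∈ I) →
    (∀ x ∈ I, ∀ a : A, x * (g * a * g) ∈ I) →
    (∀ x ∈ I, ∀ a : A, x * (g * a * g) = (g * a * g) * x) →
    ∀ x ∈ I, x = 0

/-- The generating set of `S(gAg)`: all idempotents of `gAg` together with all
commutators of elements of `gAg`. -/
def cornerGenSet {A : Type*} [Ring A] (g : A) : Set A :=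
  {x : A | x = g * x * g ∧ x * x = x} ∪
  {x : A | ∃ a b : A, x = (g * a * g) * (g * b * g) - (g * b * g) * (g * a * g)}

/-- `gAg = S(gAg)`: the corner algebra is generated (as an algebra) by its
idempotents and commutators. -/
def CornerGenerated (R : Type*) [CommRing R] {A : Type*} [Ring A] [Algebra R A]
    (g : A) : Prop :=
  ∀ x : A, g * x * g ∈ NonUnitalAlgebra.adjoin R (cornerGenSet g)

/-- Condition (*) for the corner algebra `gAg`: if `[x, gAg] ⊆ Z(gAg)` then
`x ∈ Z(gAg)`. -/
def CornerCondStar {A : Type*} [Ring A] (g : A) : Prop :=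
  ∀ x : A, x = g * x * g →
    (∀ a : A, x * (g * a * g) - (g * a * g) * x ∈ cornerCenter g) →
    x ∈ cornerCenter g

section IteratedCommutators

variable {A : Type*} [Ring A]

/-- The Leibniz expansion of `φ` on an iterated commutator, in recursive form. -/
def pComLeibniz (φ : A → A) (x : ℕ → A) : ℕ → A
  | 0 => φ (x 0)
  | k + 1 => (pComLeibniz φ x k * x (k + 1) - x (k + 1) * pComLeibniz φ x k) +
      (pCom x k * φ (x (k + 1)) - φ (x (k + 1)) * pCom x k)

theorem pCom_update_of_lt (x : ℕ → A) (a : A) {i k : ℕ} (h : k < i) :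
    pCom (Function.update x i a) k = pCom x k := by
  induction k with
  | zero => simp [pCom, Function.update_of_ne h.ne]
  | succ k ih => simp [pCom, ih (by omega), Function.update_of_ne h.ne]

theorem sum_pCom_update (φ : A → A) (x : ℕ → A) (k : ℕ) :
    ∑ i ∈ Finset.range (k + 1), pCom (Function.update x i (φ (x i))) k =
      pComLeibniz φ x k := by
  induction k with
  | zero => simp [pCom, pComLeibniz]
  | succ k ih =>
    rw [Finset.sum_range_succ, pComLeibniz, ← ih, Finset.sum_mul, Finset.mul_sum,
      ← Finset.sum_sub_distrib]
    congr 1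
    · refine Finset.sum_congr rfl fun i hi => ?_
      have : k + 1 ≠ i := by have := Finset.mem_range.mp hi; omega
      simp [pCom, Function.update_of_ne this]
    · simp [pCom, pCom_update_of_lt]

/-- The sequence `m, -e, …, -e, y, y, …` with `k` entries `-e`. -/
def peirceSeq (e m y : A) (k : ℕ) (i : ℕ) : A :=
  if i = 0 then m else if i ≤ k then -e else y

theorem pCom_peirceSeq {e m : A} (hem : e * m = m) (hme : m * e = 0) (y : A) {k j : ℕ}
    (hj : j ≤ k) : pCom (peirceSeq e m y k) j = m := by
  induction j with
  | zero => simp [pCom, peirceSeq]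
  | succ j ih => simp [pCom, ih (by omega), peirceSeq, hj, hem, hme]

theorem corner_pComLeibniz_peirceSeq {e f m : A} (he : e * e = e) (hef : e * f = 0)
    (hem : e * m = m) (hme : m * e = 0) (hmf : m * f = m)
    (φ : A → A) (hneg : φ (-e) = -φ e) (y : A) {k j : ℕ} (hj : j ≤ k) :
    e * pComLeibniz φ (peirceSeq e m y k) j * f =
      e * φ m * f + j • (e * φ e * m - m * φ e * f) := by
  induction j with
  | zero => simp [pComLeibniz, peirceSeq]
  | succ j ih =>
    have h := ih (by omega)
    have hx : peirceSeq e m y k (j + 1) = -e := by simp [peirceSeq, hj]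
    rw [pComLeibniz, pCom_peirceSeq hem hme y (by omega), hx, hneg]
    generalize pComLeibniz φ (peirceSeq e m y k) j = S at h ⊢
    have : e * (S * -e - -e * S + (m * -φ e - -φ e * m)) * f =
        e * e * S * f - e * S * (e * f) + (e * φ e * (m * f) - e * m * φ e * f) := by
      noncomm_ring
    rw [this, he, hef, hem, hmf, h, succ_nsmul]
    noncomm_ring

end IteratedCommutators

section LieNDerivations

variable {R : Type*} [CommRing R] {A : Type*} [Ring A] [Algebra R A]

theorem IsLieNDeriv.map_pCom {k : ℕ} {φ : A →ₗ[R] A} (hφ : IsLieNDeriv (k + 1) φ)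
    (x : ℕ → A) : φ (pCom x k) = pComLeibniz φ x k := by
  rw [← sum_pCom_update]
  exact hφ x

theorem IsLieNDeriv.corner_map_idempotent {k : ℕ} {φ : A →ₗ[R] A}
    (hφ : IsLieNDeriv (k + 1) φ) (hk : TorsionFreeAt A k) {e f m : A} (he : e * e = e)
    (hef : e * f = 0) (hem : e * m = m) (hme : m * e = 0) (hmf : m * f = m) :
    e * φ e * m = m * φ e * f := by
  have h := corner_pComLeibniz_peirceSeq he hef hem hme hmf φ (map_neg φ e) 0 (le_refl k)
  rw [← hφ.map_pCom, pCom_peirceSeq hem hme 0 le_rfl] at h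
  exact sub_eq_zero.mp (hk _ (left_eq_add.mp h))

theorem IsLieNDeriv.exists_map_commutator {k : ℕ} {φ : A →ₗ[R] A}
    (hφ : IsLieNDeriv (k + 2) φ) (hk : TorsionFreeAt A (k + 1)) {e f m : A} (he : e * e = e)
    (hef : e * f = 0) (hem : e * m = m) (hme : m * e = 0) (hmf : m * f = m) (y : A) :
    ∃ S : A, e * S * f = e * φ m * f ∧
      φ (m * y - y * m) = (S * y - y * S) + (m * φ y - φ y * m) := by
  refine ⟨pComLeibniz φ (peirceSeq e m y k) k, ?_, ?_⟩
  · rw [corner_pComLeibniz_peirceSeq he hef hem hme hmf φ (map_neg φ e) y le_rfl,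
      hφ.corner_map_idempotent hk he hef hem hme hmf, sub_self, smul_zero, add_zero]
  · have h := hφ.map_pCom (peirceSeq e m y k)
    have hy : peirceSeq e m y k (k + 1) = y := by simp [peirceSeq]
    rwa [pCom, pComLeibniz, pCom_peirceSeq hem hme y le_rfl, hy] at h

theorem IsLieNDeriv.corner_map_mul_comm {k : ℕ} {φ : A →ₗ[R] A}
    (hφ : IsLieNDeriv (k + 2) φ) (h2 : TorsionFreeAt A 2) (hk : TorsionFreeAt A (k + 1))
    {e f m t : A} (he : e * e = e) (hef : e * f = 0) (hfe : f * e = 0)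
    (hem : e * m = m) (hmf : m * f = m) (hft : f * t = t) (hte : t * e = t) :
    e * φ (t * m) * m = m * φ (m * t) * f := by
  have hme : m * e = 0 := by rw [← hmf, mul_assoc, hfe, mul_zero]
  have hfm : f * m = 0 := by rw [← hem, ← mul_assoc, hfe, zero_mul]
  have het : e * t = 0 := by rw [← hft, ← mul_assoc, hef, zero_mul]
  have htf : t * f = 0 := by rw [← hte, mul_assoc, hef, mul_zero]
  have hmm : m * m = 0 := by rw [← hem, mul_assoc, ← mul_assoc m, hme, zero_mul, mul_zero]
  obtain ⟨S, hS, h⟩ := hφ.exists_map_commutator hk he hef hem hme hmf t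
  obtain ⟨Sa, hSa, ha⟩ := hφ.exists_map_commutator hk he hef hem hme hmf (m * t)
  obtain ⟨Sb, hSb, hb⟩ := hφ.exists_map_commutator hk he hef hem hme hmf (t * m)
  -- the two diagonal corners of `φ [m, t]`
  have hee : e * φ (m * t) * e - e * φ (t * m) * e = e * φ m * f * t + m * φ t * e := by
    calc _ = e * φ (m * t - t * m) * e := by rw [map_sub]; noncomm_ring
      _ = e * S * (t * e) - e * t * S * e + (e * m * φ t * e - e * φ t * (m * e)) := by
        rw [h]; noncomm_ring
      _ = e * S * f * t + m * φ t * e := by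
        rw [hte, het, hem, hme, mul_assoc (e * S) f t, hft]; noncomm_ring
      _ = _ := by rw [hS]
  have hff : f * φ (t * m) * f - f * φ (m * t) * f = t * (e * φ m * f) + f * φ t * m := by
    calc _ = - (f * φ (m * t - t * m) * f) := by rw [map_sub]; noncomm_ring
      _ = f * t * S * f - f * S * (t * f) + (f * φ t * (m * f) - f * m * φ t * f) := by
        rw [h]; noncomm_ring
      _ = t * (e * S * f) + f * φ t * m := by
        rw [hft, htf, hmf, hfm, ← mul_assoc t, ← mul_assoc t, hte]; noncomm_ring
      _ = _ := by rw [hS]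
  -- the two expansions of the off-diagonal corner of `φ (m * t * m)`
  have hmtm : e * φ (m * t * m) * f =
      m * t * (e * φ m * f) - m * φ (m * t) * f + e * φ (m * t) * m := by
    calc _ = - (e * φ (m * (m * t) - m * t * m) * f) := by
          rw [← mul_assoc m m, hmm, zero_mul, zero_sub, map_neg]; noncomm_ring
      _ = e * m * t * Sa * f - e * Sa * m * (t * f) +
          (e * φ (m * t) * (m * f) - e * m * φ (m * t) * f) := by
        rw [ha]; noncomm_ring
      _ = m * t * (e * Sa * f) - m * φ (m * t) * f + e * φ (m * t) * m := by
        rw [htf, hmf, hem, ← mul_assoc (m * t), ← mul_assoc (m * t), mul_assoc m t e, hte]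
        noncomm_ring
      _ = _ := by rw [hSa]
  have hmtm' : e * φ (m * t * m) * f =
      e * φ m * f * t * m + m * φ (t * m) * f - e * φ (t * m) * m := by
    calc _ = e * φ (m * (t * m) - t * m * m) * f := by
          rw [mul_assoc t m m, hmm, mul_zero, sub_zero, mul_assoc m t m]
      _ = e * Sb * t * (m * f) - e * t * m * Sb * f +
          (e * m * φ (t * m) * f - e * φ (t * m) * (m * f)) := by
        rw [hb]; noncomm_ring
      _ = e * Sb * f * t * m + m * φ (t * m) * f - e * φ (t * m) * m := by
        rw [hmf, het, hem, mul_assoc (e * Sb) f t, hft]; noncomm_ring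
      _ = _ := by rw [hSb]
  have hl : e * φ (m * t) * m - e * φ (t * m) * m =
      e * φ m * f * t * m + m * φ t * m := by
    calc _ = (e * φ (m * t) * e - e * φ (t * m) * e) * m := by
          simp only [sub_mul, mul_assoc, hem]
      _ = _ := by rw [hee, add_mul, mul_assoc _ e m, hem]
  have hr : m * φ (t * m) * f - m * φ (m * t) * f =
      m * t * (e * φ m * f) + m * φ t * m := by
    calc _ = m * f * φ (t * m) * f - m * f * φ (m * t) * f := by rw [hmf]
      _ = m * (f * φ (t * m) * f - f * φ (m * t) * f) := by noncomm_ring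
      _ = m * t * (e * φ m * f) + m * f * φ t * m := by rw [hff]; noncomm_ring
      _ = _ := by rw [hmf]
  refine sub_eq_zero.mp (h2 _ ?_)
  rw [two_nsmul]
  have h0 := sub_eq_zero.mpr (hmtm.symm.trans hmtm')
  have hl0 := sub_eq_zero.mpr hl
  have hr0 := sub_eq_zero.mpr hr
  generalize e * φ (t * m) * m = p1 at *
  generalize m * φ (m * t) * f = p2 at *
  generalize e * φ (m * t) * m = p3 at *
  generalize m * φ (t * m) * f = p4 at *
  generalize m * φ t * m = p5 at *
  generalize m * t * (e * φ m * f) = p6 at *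
  generalize e * φ m * f * t * m = p7 at *
  calc _ = (p6 - p2 + p3 - (p7 + p4 - p1)) - (p3 - p1 - (p7 + p5)) +
      (p4 - p2 - (p6 + p5)) := by abel
    _ = 0 := by rw [h0, hl0, hr0]; simp

/-- If the centre is cut out by a single element `m₀` of the corner `e A f`, then the diagonal
corners of `φ (t * m)` and `φ (m * t)` add up to a central element. -/
theorem IsLieNDeriv.isCent_of_centerSet {k : ℕ} {φ : A →ₗ[R] A}
    (hφ : IsLieNDeriv (k + 2) φ) (h2 : TorsionFreeAt A 2) (hk : TorsionFreeAt A (k + 1))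
    {e f : A} (he : e * e = e) (hf : f * f = f) (hef : e * f = 0) (hfe : f * e = 0)
    (hie : ∀ a : A, ∃ z : A, IsCent z ∧ f * φ (e * a * e) * f = f * z * f)
    (hif : ∀ b : A, ∃ z : A, IsCent z ∧ e * φ (f * b * f) * e = e * z * e)
    {m₀ : A} (hm₀ : m₀ = e * m₀ * f)
    (hZ : ∀ a b : A, (∃ z : A, IsCent z ∧ a = e * z * e) →
      (∃ z : A, IsCent z ∧ b = f * z * f) → a * m₀ = m₀ * b → IsCent (a + b)) (m t : A) :
    IsCent (e * φ ((f * t * e) * (e * m * f)) * e +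
      f * φ ((e * m * f) * (f * t * e)) * f) := by
  have hem (m : A) : e * (e * m * f) = e * m * f := by simp only [← mul_assoc, he]
  have hmf (m : A) : e * m * f * f = e * m * f := by rw [mul_assoc, hf]
  have hft : f * (f * t * e) = f * t * e := by simp only [← mul_assoc, hf]
  have hte : f * t * e * e = f * t * e := by rw [mul_assoc, he]
  have hcomm (m : A) := hφ.corner_map_mul_comm h2 hk he hef hfe (hem m) (hmf m) hft hte
  have hcent (m : A) (h : e * φ ((f * t * e) * (e * m * f)) * e * m₀ =
      m₀ * (f * φ ((e * m * f) * (f * t * e)) * f)) :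
      IsCent (e * φ ((f * t * e) * (e * m * f)) * e +
        f * φ ((e * m * f) * (f * t * e)) * f) := by
    refine hZ _ _ ?_ ?_ h
    · have := hif (t * e * (e * m))
      simpa only [mul_assoc] using this
    · have := hie (m * f * (f * t))
      simpa only [mul_assoc] using this
  have key (m m₁ : A) (h : IsCent (e * φ ((f * t * e) * (e * m * f)) * e +
      f * φ ((e * m * f) * (f * t * e)) * f)) :
      e * φ ((f * t * e) * (e * m * f)) * (e * m₁ * f) =
        e * m₁ * f * φ ((e * m * f) * (f * t * e)) * f := by
    have h := h (e * m₁ * f)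
    rw [add_mul, mul_add, mul_assoc _ e, hem, mul_assoc _ f (e * m₁ * f)] at h
    have h1 : f * (e * m₁ * f) = 0 := by simp only [← mul_assoc, hfe, zero_mul]
    have h3 : e * m₁ * f * (e * φ ((f * t * e) * (e * m * f)) * e) = 0 := by
      simp only [← mul_assoc, mul_assoc (e * m₁) f e, hfe, mul_zero, zero_mul]
    rw [h1, h3, mul_zero, add_zero, zero_add] at h
    simpa only [← mul_assoc, mul_assoc (e * m₁) f f, hf] using h
  have heq (m : A) : (e * φ ((f * t * e) * (e * m * f)) * e * m₀ =
      m₀ * (f * φ ((e * m * f) * (f * t * e)) * f)) ↔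
      e * φ ((f * t * e) * (e * m * f)) * (e * m₀ * f) =
        e * m₀ * f * φ ((e * m * f) * (f * t * e)) * f := by
    have h1 : e * m₀ = m₀ := by rw [hm₀]; exact hem m₀
    have h3 : m₀ * f = m₀ := by rw [hm₀]; exact hmf m₀
    rw [mul_assoc _ e, h1, h3, ← mul_assoc m₀, ← mul_assoc m₀, h3]
  have hc₀ := hcent m₀ ((heq m₀).mpr (hcomm m₀))
  refine hcent m ((heq m).mpr ?_)
  have hadd := hcomm (m + m₀)
  have hm := hcomm m
  have h₀ := hcomm m₀
  have hmix := key m₀ m hc₀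
  rw [show e * (m + m₀) * f = e * m * f + e * m₀ * f by noncomm_ring] at hadd
  simp only [mul_add, add_mul, map_add] at hadd
  rw [hm, h₀, hmix] at hadd
  refine sub_eq_zero.mp ((sub_eq_zero.mpr hadd).symm.trans ?_).symm
  abel

end LieNDerivations

theorem stmt_9 (R : Type*) [CommRing R] (A : Type*) [Ring A] [Algebra R A]
    (n : ℕ) (hn : 2 ≤ n)
    (h2 : TorsionFreeAt A 2) (hn1 : TorsionFreeAt A (n - 1))
    (e : A) (he : e * e = e) (he0 : e ≠ 0) (he1 : e ≠ 1) (hQ : PropQ e)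
    (φ : A →ₗ[R] A) (hφ : IsLieNDeriv n φ)
    (hi : (∀ a : A, ∃ z : A, IsCent z ∧
          (1 - e) * φ (e * a * e) * (1 - e) = (1 - e) * z * (1 - e)) ∧
        (∀ b : A, ∃ z : A, IsCent z ∧
          e * φ ((1 - e) * b * (1 - e)) * e = e * z * e))
    (hii :
      (∃ m₀ : A, m₀ = e * m₀ * (1 - e) ∧
        centerSet A = {x : A | ∃ a b : A,
          (∃ z : A, IsCent z ∧ a = e * z * e) ∧
          (∃ z : A, IsCent z ∧ b = (1 - e) * z * (1 - e)) ∧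
          a * m₀ = m₀ * b ∧ x = a + b}) ∨
      (∃ t₀ : A, t₀ = (1 - e) * t₀ * e ∧
        centerSet A = {x : A | ∃ a b : A,
          (∃ z : A, IsCent z ∧ a = e * z * e) ∧
          (∃ z : A, IsCent z ∧ b = (1 - e) * z * (1 - e)) ∧
          t₀ * a = b * t₀ ∧ x = a + b})) :
    ∀ m t : A, IsCent
      (e * φ (((1 - e) * t * e) * (e * m * (1 - e))) * e +
       (1 - e) * φ ((e * m * (1 - e)) * ((1 - e) * t * e)) * (1 - e)) := by
  obtain ⟨k, rfl⟩ := Nat.exists_eq_add_of_le' hn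
  have hf : (1 - e) * (1 - e) = 1 - e := by
    rw [mul_sub, sub_mul, sub_mul, he]; simp
  have hef : e * (1 - e) = 0 := by rw [mul_sub, he, mul_one, sub_self]
  have hfe : (1 - e) * e = 0 := by rw [sub_mul, he, one_mul, sub_self]
  intro m t
  rcases hii with ⟨m₀, hm₀, hZ⟩ | ⟨t₀, ht₀, hZ⟩
  · refine hφ.isCent_of_centerSet h2 hn1 he hf hef hfe hi.1 hi.2 hm₀ ?_ m t
    intro a b ha hb hab
    exact hZ.symm.subset ⟨a, b, ha, hb, hab, rfl⟩
  · rw [add_comm]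
    refine hφ.isCent_of_centerSet h2 hn1 hf he hfe hef hi.2 hi.1 ht₀ ?_ t m
    intro a b ha hb hab
    exact hZ.symm.subset ⟨b, a, hb, ha, hab.symm, add_comm a b⟩
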